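/- Let τ be a critical Galton–Watson tree with offspring distribution p having bounded support, and let W(t) = sup_{h ∈ ℤ_+} Y_h(t) denote the width of a tree t. Then, along the infinite subsequence {n ∈ ℕ : P[W(τ) = n] > 0}, τ conditioned on {W(τ) = n} converges locally in distribution to the immortal tree τ* as n → ∞: for every h ∈ ℕ and every tree t of height at most h, lim_{n→∞} P[r_h(τ) = t | W(τ) = n] = P[r_h(τ*) = t]. -/

import Mathlib

open MeasureTheory Filter Set ProbabilityTheory
open scoped ENNReal Topology

namespace GWLocal

/-- Nodes of trees: finite sequences of positive integers. -/
abbrev Node : Type := List ℕ+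

/-- A (rooted planar) tree, as a subset of the set `U` of finite sequences of positive
integers: it contains the root `[]`, is closed under taking prefixes, and the children of
any node `u` form an initial segment `u1, …, uk` for some `k ∈ ℤ₊` (the out-degree of `u`). -/
def IsTree (t : Set Node) : Prop :=
  (([] : Node) ∈ t) ∧
  (∀ u ∈ t, ∀ v : Node, v <+: u → v ∈ t) ∧
  (∀ u ∈ t, ∃ k : ℕ, ∀ i : ℕ+, (u ++ [i]) ∈ t ↔ (i : ℕ) ≤ k)

/-- The out-degree `k_u(t)` of the node `u` in the tree `t`. -/
noncomputable def deg (t : Set Node) (u : Node) : ℕ := {i : ℕ+ | (u ++ [i]) ∈ t}.ncard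

/-- `restrict h t = r_h(t)`, the tree `t` restricted below height `h`. -/
def restrict (h : ℕ) (t : Set Node) : Set Node := {u ∈ t | u.length ≤ h}

/-- `Y h t = Y_h(t)`, the number of nodes of `t` at height `h`. -/
noncomputable def Y (h : ℕ) (t : Set Node) : ℕ := {u ∈ t | u.length = h}.ncard

/-- The height `H(t) = sup{|u| : u ∈ t}` of a tree. -/
noncomputable def height (t : Set Node) : ℕ∞ := ⨆ u ∈ t, (u.length : ℕ∞)

/-- The width `W(t) = sup_{h ∈ ℤ₊} Y_h(t)` of a tree. -/
noncomputable def width (t : Set Node) : ℕ∞ := ⨆ h : ℕ, (Y h t : ℕ∞)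

/-- The subtree of `t` above the node `u`, re-rooted at `u`. -/
def subtreeAt (t : Set Node) (u : Node) : Set Node := {v | u ++ v ∈ t}

/-- The mean `μ = Σ_k k p_k` of an offspring distribution `p`. -/
noncomputable def mean (p : PMF ℕ) : ℝ≥0∞ := ∑' k : ℕ, (k : ℝ≥0∞) * p k

/-- `∏_{u ∈ t, |u| < h} p_{k_u(t)}`: the probability that a GW tree with offspring
distribution `p`, restricted below height `h`, equals `t`. -/
noncomputable def cylProb (p : PMF ℕ) (h : ℕ) (t : Set Node) : ℝ≥0∞ :=
  ∏ᶠ u ∈ {u ∈ t | u.length < h}, p (deg t u)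

/-- `μ^{-b} Y_b(t) ∏_{u ∈ t, |u| < b} p_{k_u(t)}`: the probability that Kesten's immortal
tree `τ*` associated with `p`, restricted below height `b`, equals `t`. -/
noncomputable def kesten (p : PMF ℕ) (b : ℕ) (t : Set Node) : ℝ≥0∞ :=
  ((mean p)⁻¹) ^ b * (Y b t : ℝ≥0∞) * cylProb p b t

/-- The σ-algebra on the space of trees generated by the events `{t : r_h(t) = s}`
(the Borel σ-algebra of the local ultrametric on trees). -/
def treeσ : MeasurableSpace (Set Node) :=
  MeasurableSpace.generateFrom
    {S : Set (Set Node) | ∃ (h : ℕ) (s : Set Node), S = {t | restrict h t = s}}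

/-- `τ` is a Galton–Watson tree with offspring distribution `p` under `P`:
it takes values in trees, is measurable, and for every `h ∈ ℕ = {1,2,…}` and every tree `t`
of height at most `h`, `P[r_h(τ) = t] = ∏_{u ∈ t, |u| < h} p_{k_u(t)}`. -/
def IsGW {Ω : Type*} [MeasurableSpace Ω] (P : Measure Ω) (p : PMF ℕ)
    (τ : Ω → Set Node) : Prop :=
  (∀ ω, IsTree (τ ω)) ∧ (@Measurable Ω (Set Node) _ treeσ τ) ∧
  (∀ h : ℕ, 1 ≤ h → ∀ t : Set Node, IsTree t → height t ≤ (h : ℕ∞) →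
    P {ω | restrict h (τ ω) = t} = cylProb p h t)

/-- The set of nodes of `t` at height `h`. -/
abbrev level (h : ℕ) (t : Set Node) : Set Node := {u ∈ t | u.length = h}

/-- The set of finite trees. -/
def finTrees : Set (Set Node) := {s | IsTree s ∧ s.Finite}

theorem height_le_iff {t : Set Node} {h : ℕ} :
    height t ≤ (h : ℕ∞) ↔ ∀ u ∈ t, u.length ≤ h := by
  simp [height]

theorem IsTree.nil_mem {t : Set Node} (ht : IsTree t) : ([] : Node) ∈ t := ht.1

theorem IsTree.mem_of_prefix {t : Set Node} (ht : IsTree t) {u v : Node} (hu : u ∈ t)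
    (h : v <+: u) : v ∈ t := ht.2.1 u hu v h

theorem IsTree.finite_children {t : Set Node} (ht : IsTree t) {u : Node} (hu : u ∈ t) :
    {i : ℕ+ | (u ++ [i]) ∈ t}.Finite := by
  obtain ⟨k, hk⟩ := ht.2.2 u hu
  refine Set.Finite.of_injOn (f := fun i : ℕ+ => (i : ℕ)) (t := Set.Iic k) ?_
    PNat.coe_injective.injOn (Set.finite_Iic k)
  intro i hi
  exact (hk i).1 hi

theorem level_succ_eq {t : Set Node} (ht : IsTree t) (h : ℕ) :
    level (h + 1) t = ⋃ u ∈ level h t, (fun i : ℕ+ => u ++ [i]) '' {i | (u ++ [i]) ∈ t} := by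
  ext w
  simp only [level, Set.mem_ofPred_eq, Set.mem_iUnion, Set.mem_image, exists_prop]
  constructor
  · rintro ⟨hw, hl⟩
    rcases List.eq_nil_or_concat w with rfl | ⟨u, i, rfl⟩
    · simp at hl
    · refine ⟨u, ⟨ht.mem_of_prefix hw ?_, ?_⟩, i, ?_, ?_⟩
      · simp
      · simpa using hl
      · simpa using hw
      · simp
  · rintro ⟨u, ⟨-, hl⟩, i, hi, rfl⟩
    exact ⟨hi, by simp [hl]⟩

theorem IsTree.finite_level {t : Set Node} (ht : IsTree t) (h : ℕ) : (level h t).Finite := by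
  induction h with
  | zero =>
    refine (Set.finite_singleton ([] : Node)).subset ?_
    rintro u ⟨-, hu⟩
    simpa using hu
  | succ h ih =>
    rw [level_succ_eq ht]
    exact ih.biUnion fun u hu => (ht.finite_children hu.1).image _

theorem IsTree.finite_of_length_le {t : Set Node} (ht : IsTree t) {h : ℕ}
    (hh : ∀ u ∈ t, u.length ≤ h) : t.Finite := by
  refine ((Set.finite_Iic h).biUnion fun j _ => ht.finite_level j).subset ?_
  intro u hu
  simp only [Set.mem_iUnion, Set.mem_Iic]
  exact ⟨u.length, hh u hu, hu, rfl⟩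

theorem isTree_restrict {t : Set Node} (ht : IsTree t) (h : ℕ) : IsTree (restrict h t) := by
  refine ⟨⟨ht.nil_mem, by simp⟩, ?_, ?_⟩
  · rintro u ⟨hu, hl⟩ v hv
    exact ⟨ht.mem_of_prefix hu hv, hv.length_le.trans hl⟩
  · rintro u ⟨hu, hl⟩
    obtain ⟨k, hk⟩ := ht.2.2 u hu
    by_cases hlt : u.length < h
    · refine ⟨k, fun i => ?_⟩
      rw [← hk i]
      simp [restrict, hlt]
    · refine ⟨0, fun i => ?_⟩
      have := i.pos
      simp [restrict]
      omega

theorem restrict_mem_finTrees {t : Set Node} (ht : IsTree t) (h : ℕ) :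
    restrict h t ∈ finTrees :=
  ⟨isTree_restrict ht h, (isTree_restrict ht h).finite_of_length_le fun _ hu => hu.2⟩

theorem countable_finTrees : finTrees.Countable :=
  (Set.Countable.ofPred_finite (α := Node)).mono fun _ hs => hs.2

theorem exists_length_lt {s : Set Node} (hs : s.Finite) : ∃ m : ℕ, ∀ u ∈ s, u.length < m := by
  obtain ⟨m, hm⟩ := (hs.image List.length).bddAbove
  exact ⟨m + 1, fun u hu => Nat.lt_succ_of_le (hm ⟨u, hu, rfl⟩)⟩

theorem restrict_eq_iff {s t : Set Node} (ht : IsTree t) {m : ℕ} (hs : ∀ u ∈ s, u.length < m) :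
    restrict m t = s ↔ t = s := by
  constructor
  · intro h
    have key : ∀ u ∈ t, u.length ≤ m := by
      intro u hu
      by_contra! hlt
      have h1 : u.take m ∈ restrict m t :=
        ⟨ht.mem_of_prefix hu (List.take_prefix _ _), by simp⟩
      rw [h] at h1
      have := hs _ h1
      simp at this
      omega
    rw [← h]
    ext u
    exact ⟨fun hu => ⟨hu, key u hu⟩, fun hu => hu.1⟩
  · rintro rfl
    ext u
    exact ⟨fun hu => hu.1, fun hu => ⟨hu, (hs u hu).le⟩⟩

theorem isTree_subtreeAt {t : Set Node} (ht : IsTree t) {u : Node} (hu : u ∈ t) :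
    IsTree (subtreeAt t u) := by
  refine ⟨by simpa [subtreeAt] using hu, ?_, ?_⟩
  · intro v hv w hw
    exact ht.mem_of_prefix hv ((List.prefix_append_right_inj u).2 hw)
  · intro v hv
    obtain ⟨k, hk⟩ := ht.2.2 _ hv
    exact ⟨k, fun i => by simpa [subtreeAt] using hk i⟩

theorem Y_le_pow {t : Set Node} (ht : IsTree t) {N : ℕ} (hN : ∀ u ∈ t, deg t u ≤ N) (h : ℕ) :
    Y h t ≤ N ^ h := by
  classical
  induction h with
  | zero =>
    refine (Set.ncard_le_ncard (t := {([] : Node)}) ?_).trans (by simp)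
    rintro u ⟨-, hu⟩
    simpa using hu
  | succ h ih =>
    have hfin := ht.finite_level h
    have hch : ∀ u ∈ level h t, ((fun i : ℕ+ => u ++ [i]) '' {i | (u ++ [i]) ∈ t}).Finite :=
      fun u hu => (ht.finite_children hu.1).image _
    change (level (h + 1) t).ncard ≤ _
    rw [level_succ_eq ht]
    have : (⋃ u ∈ level h t, (fun i : ℕ+ => u ++ [i]) '' {i | (u ++ [i]) ∈ t}) =
        ⋃ u ∈ hfin.toFinset, (fun i : ℕ+ => u ++ [i]) '' {i | (u ++ [i]) ∈ t} := by simp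
    rw [this]
    calc _ ≤ ∑ u ∈ hfin.toFinset, ((fun i : ℕ+ => u ++ [i]) '' {i | (u ++ [i]) ∈ t}).ncard :=
          Finset.set_ncard_biUnion_le _ _
      _ ≤ ∑ u ∈ hfin.toFinset, N := by
          refine Finset.sum_le_sum fun u hu => ?_
          rw [Set.Finite.mem_toFinset] at hu
          exact (Set.ncard_image_le (ht.finite_children hu.1)).trans (hN u hu.1)
      _ = Y h t * N := by
          rw [Finset.sum_const, smul_eq_mul, Y, Set.ncard_eq_toFinset_card _ hfin]
      _ ≤ N ^ (h + 1) := by rw [pow_succ]; gcongr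

theorem Y_subtreeAt_le {t : Set Node} (ht : IsTree t) (u : Node) (j : ℕ) :
    Y j (subtreeAt t u) ≤ Y (u.length + j) t := by
  refine Set.ncard_le_ncard_of_injOn (fun v => u ++ v) ?_
    (List.append_right_injective u).injOn (ht.finite_level _)
  rintro v ⟨hv, hl⟩
  exact ⟨hv, by simp [hl]⟩

/-- If all subtrees above height `h`, except possibly the one at `u`, have height `< m`, then
the nodes at height at least `h + m` all belong to the subtree at `u`. -/
theorem Y_le_Y_subtreeAt {t : Set Node} (ht : IsTree t) {u : Node} {m j : ℕ}
    (hsub : ∀ v ∈ level u.length t, v ≠ u → ∀ w ∈ subtreeAt t v, w.length < m)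
    (hu : u ∈ t) (hj : m ≤ j) :
    Y (u.length + j) t ≤ Y j (subtreeAt t u) := by
  have : level (u.length + j) t ⊆ (fun v => u ++ v) '' level j (subtreeAt t u) := by
    rintro w ⟨hw, hl⟩
    have hsplit := List.take_append_drop u.length w
    have hmem : w.take u.length ∈ level u.length t :=
      ⟨ht.mem_of_prefix hw (List.take_prefix _ _), by simp [hl]⟩
    by_cases hne : w.take u.length = u
    · refine ⟨w.drop u.length, ⟨?_, by simp [hl]⟩, ?_⟩
      · change u ++ w.drop u.length ∈ t
        rw [hne] at hsplit
        rwa [hsplit]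
      · rw [hne] at hsplit
        exact hsplit
    · have := hsub _ hmem hne (w.drop u.length) (by
        change w.take u.length ++ w.drop u.length ∈ t
        rwa [hsplit])
      simp [hl] at this
      omega
  refine (Set.ncard_le_ncard this (((isTree_subtreeAt ht hu).finite_level j).image _)).trans ?_
  exact Set.ncard_image_le ((isTree_subtreeAt ht hu).finite_level j)

theorem width_le_iff {t : Set Node} {n : ℕ} : width t ≤ (n : ℕ∞) ↔ ∀ j, Y j t ≤ n := by
  simp [width]

theorem Y_eq_zero {t : Set Node} {m j : ℕ} (ht : ∀ u ∈ t, u.length < m) (hj : m ≤ j) :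
    Y j t = 0 := by
  have : level j t = ∅ := by
    ext u
    simp only [level, Set.mem_ofPred_eq, Set.mem_empty_iff_false, iff_false, not_and]
    intro hu
    have := ht u hu
    omega
  exact (congrArg Set.ncard this).trans (Set.ncard_empty _)

/-- Graft the trees `s u` onto the nodes `u` of `t` at height `h`. -/
def graft (h : ℕ) (t : Set Node) (s : Node → Set Node) : Set Node :=
  {w | w.take h ∈ t ∧ (h ≤ w.length → w.drop h ∈ s (w.take h))}

theorem mem_graft_of_lt {h : ℕ} {t : Set Node} {s : Node → Set Node} {w : Node}
    (hw : w.length < h) : w ∈ graft h t s ↔ w ∈ t := by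
  simp only [graft, Set.mem_ofPred_eq, List.take_of_length_le hw.le, not_le.2 hw,
    IsEmpty.forall_iff, and_true]

theorem mem_graft_append {h : ℕ} {t : Set Node} {s : Node → Set Node} {u v : Node}
    (hu : u.length = h) : u ++ v ∈ graft h t s ↔ u ∈ t ∧ v ∈ s u := by
  subst hu
  simp [graft]

theorem mem_graft_of_le {h : ℕ} {t : Set Node} {s : Node → Set Node} {w : Node}
    (hs : ∀ u ∈ level h t, IsTree (s u)) (hw : w.length ≤ h) : w ∈ graft h t s ↔ w ∈ t := by
  rcases hw.lt_or_eq with h1 | h1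
  · exact mem_graft_of_lt h1
  · have := mem_graft_append (t := t) (s := s) (v := []) h1
    rw [List.append_nil] at this
    rw [this]
    exact ⟨fun h2 => h2.1, fun h2 => ⟨h2, (hs w ⟨h2, h1⟩).nil_mem⟩⟩

theorem exists_eq_append {h : ℕ} {w : Node} (hw : h ≤ w.length) :
    ∃ u v : Node, u.length = h ∧ w = u ++ v :=
  ⟨w.take h, w.drop h, by simp [hw], by simp⟩

theorem isTree_graft {h : ℕ} {t : Set Node} {s : Node → Set Node} (ht : IsTree t)
    (hs : ∀ u ∈ level h t, IsTree (s u)) : IsTree (graft h t s) := by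
  refine ⟨?_, ?_, ?_⟩
  · rw [mem_graft_of_le hs (by simp)]
    exact ht.nil_mem
  · rintro w ⟨hw1, hw2⟩ v hv
    refine ⟨ht.mem_of_prefix hw1 (hv.take h), fun hl => ?_⟩
    have hl' := hl.trans hv.length_le
    have htake : v.take h = w.take h := (hv.take h).eq_of_length (by simp [hl, hl'])
    rw [htake]
    exact (hs _ ⟨hw1, by simp [hl']⟩).mem_of_prefix (hw2 hl') (hv.drop h)
  · intro w hw
    by_cases hl : w.length < h
    · obtain ⟨k, hk⟩ := ht.2.2 w ((mem_graft_of_lt hl).1 hw)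
      refine ⟨k, fun i => ?_⟩
      rw [mem_graft_of_le hs (by simp; omega), hk]
    · obtain ⟨u, v, hu, rfl⟩ := exists_eq_append (not_lt.1 hl)
      rw [mem_graft_append hu] at hw
      obtain ⟨k, hk⟩ := (hs u ⟨hw.1, hu⟩).2.2 v hw.2
      refine ⟨k, fun i => ?_⟩
      rw [List.append_assoc, mem_graft_append hu, hk]
      simp [hw.1]

theorem deg_graft_of_lt {h : ℕ} {t : Set Node} {s : Node → Set Node}
    (hs : ∀ u ∈ level h t, IsTree (s u)) {w : Node} (hw : w.length < h) :
    deg (graft h t s) w = deg t w := by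
  unfold deg
  congr 1
  ext i
  exact mem_graft_of_le hs (by simp; omega)

theorem deg_graft_append {h : ℕ} {t : Set Node} {s : Node → Set Node} {u v : Node}
    (hu : u ∈ level h t) : deg (graft h t s) (u ++ v) = deg (s u) v := by
  unfold deg
  congr 1
  ext i
  simp only [Set.mem_ofPred_eq, List.append_assoc]
  rw [mem_graft_append hu.2]
  simp [hu.1]

theorem subtreeAt_graft {h : ℕ} {t : Set Node} {s : Node → Set Node} {u : Node}
    (hu : u ∈ level h t) : subtreeAt (graft h t s) u = s u := by
  ext v
  exact (mem_graft_append hu.2).trans (by simp [hu.1])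

theorem restrict_graft {h : ℕ} {t : Set Node} {s : Node → Set Node}
    (hs : ∀ u ∈ level h t, IsTree (s u)) (hh : ∀ u ∈ t, u.length ≤ h) :
    restrict h (graft h t s) = t := by
  ext w
  constructor
  · rintro ⟨hw, hl⟩
    exact (mem_graft_of_le hs hl).1 hw
  · intro hw
    exact ⟨(mem_graft_of_le hs (hh w hw)).2 hw, hh w hw⟩

theorem graft_eq_union {h : ℕ} {t : Set Node} {s : Node → Set Node} :
    graft h t s = {u ∈ t | u.length < h} ∪ ⋃ u ∈ level h t, (fun v => u ++ v) '' s u := by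
  ext w
  by_cases hl : w.length < h
  · rw [mem_graft_of_lt hl]
    simp only [Set.mem_union, Set.mem_ofPred_eq, hl, and_true, Set.mem_iUnion, Set.mem_image]
    refine ⟨Or.inl, ?_⟩
    rintro (h1 | ⟨u, hu, v, -, rfl⟩)
    · exact h1
    · simp [hu.2] at hl
  · obtain ⟨u, v, hu, rfl⟩ := exists_eq_append (not_lt.1 hl)
    rw [mem_graft_append hu]
    simp only [Set.mem_union, Set.mem_ofPred_eq, hl, and_false, false_or, Set.mem_iUnion,
      Set.mem_image, exists_prop]
    constructor
    · rintro ⟨h1, h2⟩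
      exact ⟨u, ⟨h1, hu⟩, v, h2, rfl⟩
    · rintro ⟨u', ⟨h1, h2⟩, v', h3, h4⟩
      obtain ⟨rfl, rfl⟩ := List.append_inj h4 (h2.trans hu.symm)
      exact ⟨h1, h3⟩

/-- The probability that a Galton–Watson tree equals the finite tree `s`. -/
noncomputable def treeWeight (p : PMF ℕ) (s : Set Node) : ℝ≥0∞ := ∏ᶠ u ∈ s, p (deg s u)

theorem finite_lt {t : Set Node} (ht : IsTree t) (h : ℕ) : {u ∈ t | u.length < h}.Finite :=
  (restrict_mem_finTrees ht h).2.subset fun _ hu => ⟨hu.1, le_of_lt hu.2⟩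

theorem graft_mem_finTrees {h : ℕ} {t : Set Node} {s : Node → Set Node} (ht : IsTree t)
    (hs : ∀ u ∈ level h t, s u ∈ finTrees) : graft h t s ∈ finTrees := by
  refine ⟨isTree_graft ht fun u hu => (hs u hu).1, ?_⟩
  rw [graft_eq_union]
  exact (finite_lt ht h).union ((ht.finite_level h).biUnion fun u hu => (hs u hu).2.image _)

theorem treeWeight_graft (p : PMF ℕ) {h : ℕ} {t : Set Node} {s : Node → Set Node} (ht : IsTree t)
    (hs : ∀ u ∈ level h t, s u ∈ finTrees) :
    treeWeight p (graft h t s) = cylProb p h t * ∏ᶠ u ∈ level h t, treeWeight p (s u) := by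
  have hs' : ∀ u ∈ level h t, IsTree (s u) := fun u hu => (hs u hu).1
  have hfin : (⋃ u ∈ level h t, (fun v => u ++ v) '' s u).Finite :=
    (ht.finite_level h).biUnion fun u hu => (hs u hu).2.image _
  unfold treeWeight
  rw [finprod_mem_congr (graft_eq_union (h := h) (t := t) (s := s)) fun _ _ => rfl,
    finprod_mem_union ?_ (finite_lt ht h) hfin]
  · congr 1
    · exact finprod_mem_congr rfl fun u hu => by rw [deg_graft_of_lt hs' hu.2]
    · rw [finprod_mem_biUnion ?_ (ht.finite_level h) fun u hu => (hs u hu).2.image _]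
      · refine finprod_mem_congr rfl fun u hu => ?_
        rw [finprod_mem_image (List.append_right_injective u).injOn]
        exact finprod_mem_congr rfl fun v _ => by rw [deg_graft_append hu]
      · intro u hu v hv huv
        refine Set.disjoint_left.2 ?_
        rintro _ ⟨a, -, rfl⟩ ⟨b, -, h4⟩
        exact huv (List.append_inj h4 (hv.2.trans hu.2.symm)).1.symm
  · refine Set.disjoint_left.2 ?_
    rintro w hw hw'
    simp only [Set.mem_iUnion, Set.mem_image] at hw'
    obtain ⟨u, hu, v, -, rfl⟩ := hw'
    have := hw.2
    simp [hu.2] at this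

section GaltonWatson

variable {Ω : Type*} [MeasurableSpace Ω] {P : Measure Ω} {p : PMF ℕ} {τ : Ω → Set Node}

theorem IsGW.measurableSet_restrict (hGW : IsGW P p τ) (h : ℕ) (t : Set Node) :
    MeasurableSet {ω | restrict h (τ ω) = t} :=
  hGW.2.1 (MeasurableSpace.measurableSet_generateFrom ⟨h, t, rfl⟩)

theorem IsGW.exists_restrict_event (hGW : IsGW P p τ) {s : Set Node} (hs : s ∈ finTrees) :
    ∃ m : ℕ, 1 ≤ m ∧ (∀ u ∈ s, u.length < m) ∧
      {ω | τ ω = s} = {ω | restrict m (τ ω) = s} := by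
  obtain ⟨m, hm⟩ := exists_length_lt hs.2
  refine ⟨m, Nat.one_le_iff_ne_zero.2 ?_, hm, ?_⟩
  · rintro rfl
    exact absurd (hm _ hs.1.nil_mem) (by simp)
  · ext ω
    exact (restrict_eq_iff (hGW.1 ω) hm).symm

theorem IsGW.measurableSet_eq (hGW : IsGW P p τ) {s : Set Node} (hs : s ∈ finTrees) :
    MeasurableSet {ω | τ ω = s} := by
  obtain ⟨m, -, -, h⟩ := hGW.exists_restrict_event hs
  rw [h]
  exact hGW.measurableSet_restrict m s

theorem IsGW.measure_eq (hGW : IsGW P p τ) {s : Set Node} (hs : s ∈ finTrees) :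
    P {ω | τ ω = s} = treeWeight p s := by
  obtain ⟨m, h1, hm, h⟩ := hGW.exists_restrict_event hs
  rw [h, hGW.2.2 m h1 s hs.1 (height_le_iff.2 fun u hu => (hm u hu).le)]
  refine finprod_mem_congr ?_ fun _ _ => rfl
  ext u
  exact ⟨fun hu => hu.1, fun hu => ⟨hu, hm u hu⟩⟩

omit [MeasurableSpace Ω] in
theorem setOf_mem_eq_biUnion (τ : Ω → Set Node) (A : Set (Set Node)) :
    {ω | τ ω ∈ A} = ⋃ s ∈ A, {ω | τ ω = s} := by
  ext ω
  simp

theorem IsGW.measurableSet_mem (hGW : IsGW P p τ) {A : Set (Set Node)} (hA : A ⊆ finTrees) :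
    MeasurableSet {ω | τ ω ∈ A} := by
  rw [setOf_mem_eq_biUnion]
  exact .biUnion (countable_finTrees.mono hA) fun s hs => hGW.measurableSet_eq (hA hs)

theorem IsGW.measure_mem (hGW : IsGW P p τ) {A : Set (Set Node)} (hA : A ⊆ finTrees) :
    P {ω | τ ω ∈ A} = ∑' s, A.indicator (treeWeight p) s := by
  rw [setOf_mem_eq_biUnion, measure_biUnion (countable_finTrees.mono hA) ?_
    fun s hs => hGW.measurableSet_eq (hA hs), ← tsum_subtype]
  · exact tsum_congr fun s => hGW.measure_eq (hA s.2)
  · intro s _ t _ hst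
    refine Set.disjoint_left.2 fun ω (h1 : τ ω = s) (h2 : τ ω = t) => hst (h1.symm.trans h2)

/-- **Branching inequality**: conditionally on the tree below height `h`, the subtrees above
height `h` are (at least, as far as finite trees are concerned) independent Galton–Watson
trees. -/
theorem IsGW.branching_finset (hGW : IsGW P p τ) {h : ℕ} {t : Set Node} (ht : IsTree t)
    (hh : ∀ u ∈ t, u.length ≤ h) (F : Node → Finset (Set Node))
    (hF : ∀ u ∈ level h t, (F u : Set (Set Node)) ⊆ finTrees) :
    cylProb p h t * ∏ u ∈ (ht.finite_level h).toFinset, ∑ s ∈ F u, treeWeight p s ≤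
      P {ω | restrict h (τ ω) = t ∧ ∀ u ∈ level h t, subtreeAt (τ ω) u ∈ F u} := by
  classical
  set L := (ht.finite_level h).toFinset with hL
  have memL : ∀ {u}, u ∈ L ↔ u ∈ level h t := by simp [hL]
  let ext' : (∀ u ∈ L, Set Node) → Node → Set Node := fun g u =>
    if hu : u ∈ L then g u hu else ∅
  have hext : ∀ g u (hu : u ∈ L), ext' g u = g u hu := fun g u hu => dif_pos hu
  have hmem : ∀ g ∈ L.pi F, ∀ u ∈ level h t, ext' g u ∈ F u := by
    intro g hg u hu
    rw [hext g u (memL.2 hu)]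
    exact Finset.mem_pi.1 hg u (memL.2 hu)
  have hfin : ∀ g ∈ L.pi F, ∀ u ∈ level h t, ext' g u ∈ finTrees :=
    fun g hg u hu => hF u hu (hmem g hg u hu)
  rw [Finset.prod_sum, Finset.mul_sum]
  have hterm : ∀ g ∈ L.pi F, cylProb p h t * ∏ x ∈ L.attach, treeWeight p (g x.1 x.2) =
      P {ω | τ ω = graft h t (ext' g)} := by
    intro g hg
    rw [hGW.measure_eq (graft_mem_finTrees ht (hfin g hg)), treeWeight_graft p ht (hfin g hg),
      finprod_mem_eq_finite_toFinset_prod _ (ht.finite_level h), ← hL,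
      ← Finset.prod_attach L fun u => treeWeight p (ext' g u)]
    congr 1
    exact Finset.prod_congr rfl fun x _ => by rw [hext g x.1 x.2]
  rw [Finset.sum_congr rfl hterm, ← measure_biUnion_finset ?_
    fun g hg => hGW.measurableSet_eq (graft_mem_finTrees ht (hfin g hg))]
  · refine measure_mono ?_
    intro ω hω
    simp only [Set.mem_iUnion, exists_prop] at hω
    obtain ⟨g, hg, hω⟩ := hω
    change τ ω = _ at hω
    refine ⟨?_, fun u hu => ?_⟩
    · rw [hω]
      exact restrict_graft (fun u hu => (hfin g hg u hu).1) hh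
    · rw [hω, subtreeAt_graft hu]
      exact hmem g hg u hu
  · intro g hg g' hg' hne
    refine Set.disjoint_left.2 fun ω (h1 : τ ω = _) (h2 : τ ω = _) => hne ?_
    funext u hu
    rw [← hext g u hu, ← hext g' u hu, ← subtreeAt_graft (s := ext' g) (memL.1 hu), ← h1, h2,
      subtreeAt_graft (memL.1 hu)]

theorem IsGW.branching [IsProbabilityMeasure P] (hGW : IsGW P p τ) {h : ℕ} {t : Set Node}
    (ht : IsTree t) (hh : ∀ u ∈ t, u.length ≤ h) (A : Node → Set (Set Node))
    (hA : ∀ u ∈ level h t, A u ⊆ finTrees) :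
    cylProb p h t * ∏ u ∈ (ht.finite_level h).toFinset, P {ω | τ ω ∈ A u} ≤
      P {ω | restrict h (τ ω) = t ∧ ∀ u ∈ level h t, subtreeAt (τ ω) u ∈ A u} := by
  classical
  have hlim : Tendsto (fun G : Finset (Set Node) =>
      cylProb p h t * ∏ u ∈ (ht.finite_level h).toFinset,
        ∑ s ∈ G, (A u).indicator (treeWeight p) s) atTop
      (𝓝 (cylProb p h t * ∏ u ∈ (ht.finite_level h).toFinset, P {ω | τ ω ∈ A u})) := by
    refine ENNReal.Tendsto.const_mul ?_ (Or.inr ?_)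
    · refine ENNReal.tendsto_finsetProd_of_ne_top _ (fun u hu => ?_)
        fun u _ => measure_ne_top _ _
      rw [Set.Finite.mem_toFinset] at hu
      rw [hGW.measure_mem (hA u hu)]
      exact ENNReal.summable.hasSum
    · refine finprod_mem_induction (· ≠ ⊤) ENNReal.one_ne_top
        (fun _ _ => ENNReal.mul_ne_top) fun u _ => p.apply_ne_top _
  refine le_of_tendsto hlim (Eventually.of_forall fun G => ?_)
  have := hGW.branching_finset ht hh (fun u => G.filter (· ∈ A u)) (by
    intro u hu s hs
    simp only [Finset.coe_filter, Set.mem_ofPred_eq] at hs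
    exact hA u hu hs.2)
  refine le_trans (le_of_eq ?_) (this.trans (measure_mono ?_))
  · congr 1
    refine Finset.prod_congr rfl fun u _ => ?_
    rw [Finset.sum_filter]
    rfl
  · rintro ω ⟨h1, h2⟩
    exact ⟨h1, fun u hu => (Finset.mem_filter.1 (h2 u hu)).2⟩

/-- The tree of height at most one whose root has `k` children. -/
def star (k : ℕ) : Set Node := {u | u = [] ∨ ∃ i : ℕ+, (i : ℕ) ≤ k ∧ u = [i]}

theorem singleton_mem_star {k : ℕ} {i : ℕ+} : [i] ∈ star k ↔ (i : ℕ) ≤ k := by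
  simp [star]

theorem length_le_one_of_mem_star {k : ℕ} {u : Node} (hu : u ∈ star k) : u.length ≤ 1 := by
  rcases hu with rfl | ⟨i, -, rfl⟩ <;> simp

theorem isTree_star (k : ℕ) : IsTree (star k) := by
  refine ⟨Or.inl rfl, ?_, ?_⟩
  · rintro u hu v hv
    by_cases h0 : v.length = 0
    · exact Or.inl (List.length_eq_zero_iff.1 h0)
    · have h1 := hv.length_le
      have h2 := length_le_one_of_mem_star hu
      rwa [hv.eq_of_length (by omega)]
  · rintro u (rfl | ⟨j, -, rfl⟩)
    · exact ⟨k, fun i => by simp [star]⟩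
    · exact ⟨0, fun i => by simp [star]⟩

theorem deg_nil_star (k : ℕ) : deg (star k) [] = k := by
  have : (fun i : ℕ+ => (i : ℕ)) '' {i : ℕ+ | ([] : Node) ++ [i] ∈ star k} = Set.Icc 1 k := by
    ext j
    simp only [List.nil_append, singleton_mem_star, Set.mem_image, Set.mem_ofPred_eq, Set.mem_Icc]
    constructor
    · rintro ⟨i, hi, rfl⟩
      exact ⟨i.pos, hi⟩
    · rintro ⟨h1, h2⟩
      exact ⟨⟨j, h1⟩, h2, rfl⟩
  rw [deg, ← Set.ncard_image_of_injective _ PNat.coe_injective, this, ← Finset.coe_Icc,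
    Set.ncard_coe_finset]
  simp

theorem level_one_star (k : ℕ) :
    level 1 (star k) = (fun i : ℕ+ => ([i] : Node)) '' {i : ℕ+ | (i : ℕ) ≤ k} := by
  ext u
  constructor
  · rintro ⟨rfl | ⟨i, hi, rfl⟩, hl⟩
    · simp at hl
    · exact ⟨i, hi, rfl⟩
  · rintro ⟨i, hi, rfl⟩
    exact ⟨Or.inr ⟨i, hi, rfl⟩, rfl⟩

theorem Y_one_star (k : ℕ) : Y 1 (star k) = k := by
  have h := deg_nil_star k
  change (level 1 (star k)).ncard = k
  rw [level_one_star, Set.ncard_image_of_injective _ (List.singleton_injective)]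
  simpa [deg, singleton_mem_star] using h

theorem star_injective : Function.Injective star := fun k l h => by
  rw [← deg_nil_star k, h, deg_nil_star]

theorem cylProb_star (p : PMF ℕ) (k : ℕ) : cylProb p 1 (star k) = p k := by
  have : {u ∈ star k | u.length < 1} = {([] : Node)} := by
    ext u
    simp only [Set.mem_ofPred_eq, Nat.lt_one_iff, List.length_eq_zero_iff, Set.mem_singleton_iff]
    exact ⟨fun h => h.2, fun h => ⟨Or.inl h, h⟩⟩
  rw [cylProb, finprod_mem_congr this fun _ _ => rfl, finprod_mem_singleton, deg_nil_star]

theorem IsGW.sum_measure_inter_star_le (hGW : IsGW P p τ) (B : Set Ω) :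
    ∑' k, P ({ω | restrict 1 (τ ω) = star k} ∩ B) ≤ P B := by
  have h1 : ∀ k, P ({ω | restrict 1 (τ ω) = star k} ∩ B) =
      P.restrict B {ω | restrict 1 (τ ω) = star k} := fun k =>
    (Measure.restrict_apply (hGW.measurableSet_restrict 1 _)).symm
  simp_rw [h1]
  rw [← measure_iUnion ?_ fun k => hGW.measurableSet_restrict 1 _]
  · exact (measure_mono (Set.subset_univ _)).trans (by simp)
  · intro k l hkl
    exact Set.disjoint_left.2 fun ω (h1 : _ = _) (h2 : _ = _) =>
      hkl (star_injective (h1.symm.trans h2))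

theorem finite_of_finite_subtrees {t : Set Node} (ht : IsTree t) (h : ℕ)
    (hsub : ∀ u ∈ level h t, (subtreeAt t u).Finite) : t.Finite := by
  refine ((finite_lt ht h).union
    ((ht.finite_level h).biUnion fun u hu => (hsub u hu).image (fun v => u ++ v))).subset ?_
  intro w hw
  by_cases hl : w.length < h
  · exact Or.inl ⟨hw, hl⟩
  · obtain ⟨u, v, hu, rfl⟩ := exists_eq_append (not_lt.1 hl)
    refine Or.inr ?_
    simp only [Set.mem_iUnion, Set.mem_image, exists_prop]
    exact ⟨u, ⟨ht.mem_of_prefix hw (List.prefix_append u v), hu⟩, v, hw, rfl⟩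

theorem level_restrict {h : ℕ} {t : Set Node} : level h (restrict h t) = level h t := by
  ext u
  constructor
  · rintro ⟨⟨h1, -⟩, h2⟩
    exact ⟨h1, h2⟩
  · rintro ⟨h1, h2⟩
    exact ⟨⟨h1, h2.le⟩, h2⟩

/-- The generating function of a nondegenerate critical offspring distribution has no fixed
point below `1`, nor does it go below the diagonal. -/
theorem eq_one_of_tsum_mul_pow_le (hp1 : p 1 < 1) (hcrit : mean p = 1)
    (hbdd : ∃ N : ℕ, ∀ k : ℕ, N < k → p k = 0) {e : ℝ≥0∞} (he : e ≤ 1)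
    (hle : ∑' k, p k * e ^ k ≤ e) : e = 1 := by
  obtain ⟨N, hN⟩ := hbdd
  by_contra hne
  have hlt : e < 1 := lt_of_le_of_ne he hne
  have hetop : e ≠ ⊤ := (hlt.trans ENNReal.one_lt_top).ne
  have hz : ∀ k ∉ Finset.range (N + 1), p k = 0 := fun k hk => hN k (by simpa using hk)
  have s0 : ∑ k ∈ Finset.range (N + 1), p k = 1 := by
    rw [← p.tsum_coe, tsum_eq_sum hz]
  have s1 : ∑ k ∈ Finset.range (N + 1), (k : ℝ≥0∞) * p k = 1 := by
    rw [← hcrit, mean, tsum_eq_sum fun k hk => by rw [hz k hk, mul_zero]]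
  have s2 : ∑ k ∈ Finset.range (N + 1), p k * e ^ k ≤ e := by
    rwa [tsum_eq_sum fun k hk => by rw [hz k hk, zero_mul]] at hle
  set q : ℕ → ℝ := fun k => (p k).toReal with hq
  set x : ℝ := e.toReal with hx
  have hx0 : 0 ≤ x := ENNReal.toReal_nonneg
  have hx1 : x < 1 := by
    rw [hx, ← ENNReal.toReal_one]
    exact (ENNReal.toReal_lt_toReal hetop ENNReal.one_ne_top).2 hlt
  have r0 : ∑ k ∈ Finset.range (N + 1), q k = 1 := by
    rw [← ENNReal.toReal_sum fun k _ => p.apply_ne_top k, s0, ENNReal.toReal_one]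
  have r1 : ∑ k ∈ Finset.range (N + 1), (k : ℝ) * q k = 1 := by
    rw [← ENNReal.toReal_one, ← s1, ENNReal.toReal_sum fun k _ =>
      ENNReal.mul_ne_top (ENNReal.natCast_ne_top k) (p.apply_ne_top k)]
    simp [hq]
  have r2 : ∑ k ∈ Finset.range (N + 1), q k * x ^ k ≤ x := by
    have := ENNReal.toReal_mono hetop s2
    rw [ENNReal.toReal_sum fun k _ =>
      ENNReal.mul_ne_top (p.apply_ne_top k) (ENNReal.pow_ne_top hetop)] at this
    simpa [hq, hx] using this
  have bern : ∀ k : ℕ, 0 ≤ x ^ k - 1 + k * (1 - x) := by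
    intro k
    have := one_add_mul_le_pow (a := x - 1) (by linarith) k
    rw [add_sub_cancel] at this
    linarith
  have bern' : ∀ k : ℕ, 2 ≤ k → 0 < x ^ k - 1 + k * (1 - x) := by
    intro k hk
    have := one_add_mul_self_lt_rpow_one_add (s := x - 1) (by linarith) (by linarith)
      (p := k) (by exact_mod_cast hk)
    rw [add_sub_cancel, Real.rpow_natCast] at this
    linarith
  have hsum : ∑ k ∈ Finset.range (N + 1), q k * (x ^ k - 1 + k * (1 - x)) ≤ 0 := by
    have : ∑ k ∈ Finset.range (N + 1), q k * (x ^ k - 1 + k * (1 - x)) =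
        ∑ k ∈ Finset.range (N + 1), q k * x ^ k - ∑ k ∈ Finset.range (N + 1), q k +
          (1 - x) * ∑ k ∈ Finset.range (N + 1), (k : ℝ) * q k := by
      rw [Finset.mul_sum, ← Finset.sum_sub_distrib, ← Finset.sum_add_distrib]
      exact Finset.sum_congr rfl fun k _ => by ring
    rw [this, r0, r1]
    linarith
  have hnn : ∀ k ∈ Finset.range (N + 1), 0 ≤ q k * (x ^ k - 1 + k * (1 - x)) :=
    fun k _ => mul_nonneg ENNReal.toReal_nonneg (bern k)
  have hzero := (Finset.sum_eq_zero_iff_of_nonneg hnn).1 (le_antisymm hsum (Finset.sum_nonneg hnn))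
  have hbig : ∀ k : ℕ, k ≠ 1 → (k : ℝ≥0∞) * p k = 0 := by
    intro k hk
    by_cases hkN : k ∈ Finset.range (N + 1)
    · rcases Nat.lt_or_ge k 2 with h2 | h2
      · have : k = 0 := by omega
        simp [this]
      · have := (mul_eq_zero.1 (hzero k hkN)).resolve_right (bern' k h2).ne'
        rw [(ENNReal.toReal_eq_zero_iff _).1 this |>.resolve_right (p.apply_ne_top k), mul_zero]
    · rw [hz k hkN, mul_zero]
  rw [mean, tsum_eq_single 1 hbig, Nat.cast_one, one_mul] at hcrit
  exact hp1.ne hcrit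

theorem card_level {h : ℕ} {t : Set Node} (ht : IsTree t) :
    (ht.finite_level h).toFinset.card = Y h t :=
  (Set.ncard_eq_toFinset_card _ _).symm

theorem IsGW.measure_finTrees [IsProbabilityMeasure P] (hGW : IsGW P p τ) (hp1 : p 1 < 1)
    (hcrit : mean p = 1) (hbdd : ∃ N : ℕ, ∀ k : ℕ, N < k → p k = 0) :
    P {ω | τ ω ∈ finTrees} = 1 := by
  refine eq_one_of_tsum_mul_pow_le hp1 hcrit hbdd prob_le_one ?_
  refine le_trans (ENNReal.tsum_le_tsum fun k => ?_)
    (hGW.sum_measure_inter_star_le {ω | τ ω ∈ finTrees})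
  have := hGW.branching (isTree_star k) (fun u hu => length_le_one_of_mem_star hu)
    (fun _ => finTrees) (fun _ _ => subset_rfl)
  rw [Finset.prod_const, card_level (isTree_star k), Y_one_star, cylProb_star] at this
  refine this.trans (measure_mono ?_)
  rintro ω ⟨h1, h2⟩
  refine ⟨h1, hGW.1 ω, finite_of_finite_subtrees (hGW.1 ω) 1 fun u hu => ?_⟩
  rw [← level_restrict, h1] at hu
  exact (h2 u hu).2

theorem IsGW.ae_mem_finTrees [IsProbabilityMeasure P] (hGW : IsGW P p τ) (hp1 : p 1 < 1)
    (hcrit : mean p = 1) (hbdd : ∃ N : ℕ, ∀ k : ℕ, N < k → p k = 0) :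
    ∀ᵐ ω ∂P, τ ω ∈ finTrees :=
  (prob_compl_eq_zero_iff (hGW.measurableSet_mem subset_rfl)).2
    (hGW.measure_finTrees hp1 hcrit hbdd)

theorem IsGW.ae_deg_le [IsProbabilityMeasure P] (hGW : IsGW P p τ) (hp1 : p 1 < 1)
    (hcrit : mean p = 1) {N : ℕ} (hN : ∀ k : ℕ, N < k → p k = 0) :
    ∀ᵐ ω ∂P, τ ω ∈ {s ∈ finTrees | ∀ u ∈ s, deg s u ≤ N} := by
  have hnull : P {ω | τ ω ∈ {s ∈ finTrees | ∃ u ∈ s, N < deg s u}} = 0 := by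
    rw [hGW.measure_mem fun s hs => hs.1, ENNReal.tsum_eq_zero]
    intro s
    refine Set.indicator_apply_eq_zero.2 ?_
    rintro ⟨hs, u, hu, hlt⟩
    rw [treeWeight, finprod_mem_eq_finite_toFinset_prod _ hs.2]
    exact Finset.prod_eq_zero (i := u) (by simpa using hu) (hN _ hlt)
  filter_upwards [hGW.ae_mem_finTrees hp1 hcrit ⟨N, hN⟩, measure_eq_zero_iff_ae_notMem.1 hnull]
    with ω h1 h2
  refine ⟨h1, fun u hu => not_lt.1 fun hlt => h2 ⟨h1, u, hu, hlt⟩⟩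

theorem IsGW.mul_measure_le_measure_cons [IsProbabilityMeasure P] (hGW : IsGW P p τ)
    (hfin : P {ω | τ ω ∈ finTrees} = 1) (i : ℕ+) (u : Node) :
    (∑' k, if (i : ℕ) ≤ k then p k else 0) * P {ω | u ∈ τ ω} ≤ P {ω | i :: u ∈ τ ω} := by
  classical
  rw [← ENNReal.tsum_mul_right]
  refine le_trans (ENNReal.tsum_le_tsum fun k => ?_)
    (hGW.sum_measure_inter_star_le {ω | i :: u ∈ τ ω})
  split_ifs with hik
  swap
  · simp
  have := hGW.branching (isTree_star k) (fun u hu => length_le_one_of_mem_star hu)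
    (fun v => if v = [i] then {s ∈ finTrees | u ∈ s} else finTrees) (fun v _ => by
      split_ifs
      · exact fun s hs => hs.1
      · exact subset_rfl)
  rw [cylProb_star, Finset.prod_eq_single [i]] at this
  · rw [if_pos rfl] at this
    have hu : P {ω | u ∈ τ ω} = P {ω | τ ω ∈ {s ∈ finTrees | u ∈ s}} := by
      refine measure_congr ?_
      filter_upwards [(prob_compl_eq_zero_iff (hGW.measurableSet_mem subset_rfl)).2 hfin]
        with ω hω
      exact propext ⟨fun h => ⟨hω, h⟩, fun h => h.2⟩
    rw [hu]
    refine this.trans (measure_mono ?_)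
    rintro ω ⟨h1, h2⟩
    refine ⟨h1, ?_⟩
    have h3 := h2 [i] ⟨singleton_mem_star.2 hik, rfl⟩
    rw [if_pos rfl] at h3
    exact h3.2
  · intro v _ hv
    rw [if_neg hv, hfin]
  · intro h
    refine absurd ?_ h
    rw [Set.Finite.mem_toFinset]
    exact ⟨singleton_mem_star.2 hik, rfl⟩

theorem tsum_tail_eq_mean (p : PMF ℕ) :
    ∑' i : ℕ+, ∑' k, (if (i : ℕ) ≤ k then p k else 0) = mean p := by
  rw [ENNReal.tsum_comm, mean]
  refine tsum_congr fun k => ?_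
  have h1 : ∀ i : ℕ+, (if (i : ℕ) ≤ k then p k else 0) =
      {i : ℕ+ | (i : ℕ) ≤ k}.indicator (fun _ => p k) i := fun i => by
    simp [Set.indicator_apply]
  simp_rw [h1]
  rw [← tsum_subtype, ENNReal.tsum_set_const]
  have h2 := Y_one_star k
  change (level 1 (star k)).ncard = k at h2
  have hfin : {i : ℕ+ | (i : ℕ) ≤ k}.Finite :=
    Set.Finite.of_injOn (f := fun i : ℕ+ => (i : ℕ)) (t := Set.Iic k) (fun _ hi => hi)
      PNat.coe_injective.injOn (Set.finite_Iic k)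
  rw [level_one_star, Set.ncard_image_of_injective _ (List.singleton_injective)] at h2
  rw [← hfin.cast_ncard_eq, h2]
  simp

/-- The expected number of nodes at height `h` is at least one. -/
theorem IsGW.one_le_tsum_measure_mem [IsProbabilityMeasure P] (hGW : IsGW P p τ)
    (hfin : P {ω | τ ω ∈ finTrees} = 1) (hcrit : mean p = 1) (h : ℕ) :
    1 ≤ ∑' u : Node, if u.length = h then P {ω | u ∈ τ ω} else 0 := by
  induction h with
  | zero =>
    refine le_trans ?_ (ENNReal.le_tsum ([] : Node))
    have : {ω | ([] : Node) ∈ τ ω} = Set.univ := by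
      ext ω
      simp [(hGW.1 ω).nil_mem]
    simp [this]
  | succ h ih =>
    have hinj : Function.Injective fun x : ℕ+ × Node => x.1 :: x.2 := by
      rintro ⟨i, u⟩ ⟨j, v⟩ hx
      simpa using hx
    refine le_trans ?_ (ENNReal.tsum_comp_le_tsum_of_injective hinj _)
    rw [ENNReal.tsum_prod']
    calc (1 : ℝ≥0∞) ≤ (∑' i : ℕ+, ∑' k, (if (i : ℕ) ≤ k then p k else 0)) *
          ∑' u : Node, if u.length = h then P {ω | u ∈ τ ω} else 0 := by
          rw [tsum_tail_eq_mean, hcrit, one_mul]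
          exact ih
      _ ≤ _ := by
          rw [← ENNReal.tsum_mul_right]
          refine ENNReal.tsum_le_tsum fun i => ?_
          rw [← ENNReal.tsum_mul_left]
          refine ENNReal.tsum_le_tsum fun u => ?_
          by_cases hu : u.length = h
          · simpa [hu] using hGW.mul_measure_le_measure_cons hfin i u
          · simp [hu]

theorem IsGW.one_le_tsum_kesten [IsProbabilityMeasure P] (hGW : IsGW P p τ)
    (hfin : P {ω | τ ω ∈ finTrees} = 1) (hcrit : mean p = 1) {h : ℕ} (hh : 1 ≤ h) :
    1 ≤ ∑' t : {t : Set Node | IsTree t ∧ ∀ u ∈ t, u.length ≤ h}, kesten p h t := by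
  set T : Set (Set Node) := {t : Set Node | IsTree t ∧ ∀ u ∈ t, u.length ≤ h} with hT
  have hTfin : T ⊆ finTrees := fun t ht => ⟨ht.1, ht.1.finite_of_length_le ht.2⟩
  have : Countable T := (countable_finTrees.mono hTfin).to_subtype
  refine (hGW.one_le_tsum_measure_mem hfin hcrit h).trans ?_
  calc ∑' u : Node, (if u.length = h then P {ω | u ∈ τ ω} else 0)
      ≤ ∑' u : Node, ∑' t : T,
          (level h (t : Set Node)).indicator (fun _ => P {ω | restrict h (τ ω) = t}) u := by
        refine ENNReal.tsum_le_tsum fun u => ?_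
        split_ifs with hu
        swap
        · exact zero_le
        have hsub : {ω | u ∈ τ ω} ⊆ ⋃ t : T, {ω | restrict h (τ ω) = t ∧ u ∈ (t : Set Node)} := by
          intro ω hω
          rw [Set.mem_iUnion]
          exact ⟨⟨restrict h (τ ω), isTree_restrict (hGW.1 ω) h, fun v hv => hv.2⟩, rfl, hω, hu.le⟩
        refine (measure_mono hsub).trans ((measure_iUnion_le _).trans ?_)
        refine ENNReal.tsum_le_tsum fun t => ?_
        by_cases hut : u ∈ (t : Set Node)
        · rw [Set.indicator_of_mem (show u ∈ level h (t : Set Node) from ⟨hut, hu⟩)]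
          exact measure_mono fun ω hω => hω.1
        · simp [hut]
    _ = ∑' t : T, kesten p h t := by
        rw [ENNReal.tsum_comm]
        refine tsum_congr fun t => ?_
        rw [← tsum_subtype, ENNReal.tsum_set_const,
          ← (t.2.1.finite_level h).cast_ncard_eq, kesten, hcrit,
          hGW.2.2 h hh t t.2.1 (height_le_iff.2 t.2.2)]
        simp [Y]

theorem tendsto_measure_height_lt [IsProbabilityMeasure P]
    (hfin : P {ω | τ ω ∈ finTrees} = 1) :
    Tendsto (fun m : ℕ => P {ω | τ ω ∈ {s ∈ finTrees | ∀ w ∈ s, w.length < m}}) atTop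
      (𝓝 1) := by
  have hunion : ⋃ m : ℕ, {ω | τ ω ∈ {s ∈ finTrees | ∀ w ∈ s, w.length < m}} =
      {ω | τ ω ∈ finTrees} := by
    ext ω
    simp only [Set.mem_iUnion]
    refine ⟨fun ⟨m, hm⟩ => hm.1, fun hω => ?_⟩
    obtain ⟨m, hm⟩ := exists_length_lt (s := τ ω) hω.2
    exact ⟨m, hω, hm⟩
  rw [← hfin, ← hunion]
  refine tendsto_measure_iUnion_atTop fun m n hmn ω hω => ?_
  exact ⟨hω.1, fun w hw => (hω.2 w hw).trans_le hmn⟩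

/-- If the subtree at `u` has width `n`, the other subtrees above height `h` have height `< m`,
and `n` is large, then the whole tree has width `n`. -/
theorem width_eq_of_width_subtreeAt {t : Set Node} (ht : IsTree t) {N m n : ℕ} (hN1 : 1 ≤ N)
    (hN : ∀ u ∈ t, deg t u ≤ N) {u : Node} (hu : u ∈ t) (hn : N ^ (u.length + m) < n)
    (hw : width (subtreeAt t u) = n)
    (hsub : ∀ v ∈ level u.length t, v ≠ u → ∀ w ∈ subtreeAt t v, w.length < m) :
    width t = n := by
  refine le_antisymm (width_le_iff.2 fun j => ?_) ?_
  · rcases Nat.lt_or_ge j (u.length + m) with hj | hj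
    · exact (Y_le_pow ht hN j).trans ((Nat.pow_le_pow_right hN1 hj.le).trans hn.le)
    · obtain ⟨i, rfl⟩ := Nat.exists_eq_add_of_le (show u.length ≤ j by omega)
      exact (Y_le_Y_subtreeAt ht hsub hu (by omega)).trans (width_le_iff.1 hw.le i)
  · rw [← hw]
    exact iSup_le fun i => (Nat.cast_le.2 (Y_subtreeAt_le ht u i)).trans
      (le_iSup (fun j => (Y j t : ℕ∞)) _)

theorem width_subtreeAt_le {t : Set Node} (ht : IsTree t) {N m : ℕ} (hN1 : 1 ≤ N)
    (hN : ∀ u ∈ t, deg t u ≤ N) {u : Node} (hsub : ∀ w ∈ subtreeAt t u, w.length < m) :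
    width (subtreeAt t u) ≤ (N ^ (u.length + m) : ℕ) := by
  refine width_le_iff.2 fun j => ?_
  rcases Nat.lt_or_ge j m with hj | hj
  · exact (Y_subtreeAt_le ht u j).trans ((Y_le_pow ht hN _).trans
      (Nat.pow_le_pow_right hN1 (by omega)))
  · rw [Y_eq_zero hsub hj]
    exact Nat.zero_le _

theorem IsGW.kesten_mul_le [IsProbabilityMeasure P] (hGW : IsGW P p τ) (hp1 : p 1 < 1)
    (hcrit : mean p = 1) {N : ℕ} (hN1 : 1 ≤ N) (hN : ∀ k : ℕ, N < k → p k = 0)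
    {h : ℕ} {t : Set Node} (ht : IsTree t) (hh : ∀ u ∈ t, u.length ≤ h) {m n : ℕ}
    (hn : N ^ (h + m) < n) :
    kesten p h t * P {ω | τ ω ∈ {s ∈ finTrees | ∀ w ∈ s, w.length < m}} ^ (Y h t - 1) *
        P {ω | width (τ ω) = n} ≤
      P ({ω | restrict h (τ ω) = t} ∩ {ω | width (τ ω) = n}) := by
  classical
  set B : Set (Set Node) := {s ∈ finTrees | ∀ w ∈ s, w.length < m} with hB
  set W : Set (Set Node) := {s ∈ finTrees | width s = n} with hW
  set G : Set (Set Node) := {s ∈ finTrees | ∀ u ∈ s, deg s u ≤ N} with hG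
  have hPW : P {ω | width (τ ω) = n} = P {ω | τ ω ∈ W} := by
    refine measure_congr ?_
    filter_upwards [hGW.ae_mem_finTrees hp1 hcrit ⟨N, hN⟩] with ω hω
    exact propext ⟨fun h => ⟨hω, h⟩, fun h => h.2⟩
  let A : Node → Node → Set (Set Node) := fun u => Function.update (fun _ => B) u W
  have hAself : ∀ u, A u u = W := fun u => Function.update_self _ _ _
  have hAne : ∀ u v, v ≠ u → A u v = B := fun u v hv => Function.update_of_ne hv _ _
  let E : Node → Set (Set Node) := fun u =>
    {s ∈ G | restrict h s = t ∧ ∀ v ∈ level h t, subtreeAt s v ∈ A u v}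
  set L := (ht.finite_level h).toFinset with hL
  have memL : ∀ {u}, u ∈ L ↔ u ∈ level h t := by simp [hL]
  have hEmeas : ∀ u, MeasurableSet {ω | τ ω ∈ E u} := fun u =>
    hGW.measurableSet_mem fun s hs => hs.1.1
  have hE : ∀ u ∈ L, cylProb p h t * (P {ω | τ ω ∈ W} * P {ω | τ ω ∈ B} ^ (Y h t - 1)) ≤
      P {ω | τ ω ∈ E u} := by
    intro u hu
    have hbr := hGW.branching ht hh (A u) (fun v _ => by
      by_cases hv : v = u
      · rw [hv, hAself]
        exact fun s hs => hs.1
      · rw [hAne u v hv]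
        exact fun s hs => hs.1)
    rw [← hL, ← Finset.mul_prod_erase _ _ hu, hAself,
      Finset.prod_congr rfl fun v hv => by rw [hAne u v (Finset.ne_of_mem_erase hv)],
      Finset.prod_const, Finset.card_erase_of_mem hu, hL, card_level ht] at hbr
    refine hbr.trans (measure_mono_ae ?_)
    filter_upwards [hGW.ae_deg_le hp1 hcrit hN] with ω hω h1
    exact ⟨hω, h1⟩
  have hlev : ∀ {u s}, u ∈ L → s ∈ E u → u ∈ s := by
    intro u s hu hs
    have := (memL.1 hu).1
    rw [← hs.2.1] at this
    exact this.1
  have hlen : ∀ {u}, u ∈ L → u.length = h := fun hu => (memL.1 hu).2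
  calc _ = ∑ u ∈ L, cylProb p h t * (P {ω | τ ω ∈ W} * P {ω | τ ω ∈ B} ^ (Y h t - 1)) := by
        rw [Finset.sum_const, hL, card_level ht, hPW, kesten, hcrit]
        simp only [inv_one, one_pow, one_mul, nsmul_eq_mul]
        ring
    _ ≤ ∑ u ∈ L, P {ω | τ ω ∈ E u} := Finset.sum_le_sum hE
    _ = P (⋃ u ∈ L, {ω | τ ω ∈ E u}) := by
        rw [measure_biUnion_finset ?_ fun u _ => hEmeas u]
        intro u hu v hv huv
        refine Set.disjoint_left.2 fun ω (h1 : τ ω ∈ E u) (h2 : τ ω ∈ E v) => ?_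
        have hw : subtreeAt (τ ω) u ∈ W := hAself u ▸ h1.2.2 u (memL.1 hu)
        have hb : subtreeAt (τ ω) u ∈ B := hAne v u huv ▸ h2.2.2 u (memL.1 hu)
        have := width_subtreeAt_le (hGW.1 ω) hN1 h1.1.2 hb.2
        rw [hw.2, hlen hu, Nat.cast_le] at this
        omega
    _ ≤ _ := by
        refine measure_mono fun ω hω => ?_
        simp only [Set.mem_iUnion, exists_prop] at hω
        obtain ⟨u, hu, hω⟩ := hω
        refine ⟨hω.2.1, ?_⟩
        have hw : subtreeAt (τ ω) u ∈ W := hAself u ▸ hω.2.2 u (memL.1 hu)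
        refine width_eq_of_width_subtreeAt (hGW.1 ω) (m := m) hN1 hω.1.2 (hlev hu hω)
          (by rwa [hlen hu]) hw.2 fun v hv hvu => ?_
        rw [hlen hu, ← level_restrict, hω.2.1] at hv
        have hb : subtreeAt (τ ω) v ∈ B := hAne u v hvu ▸ hω.2.2 v hv
        exact hb.2

end GaltonWatson

/-- Scheffé-type principle: a family of subprobabilities whose lower limits are bounded below by
a probability converges to that probability. -/
theorem tendsto_of_forall_lt_eventually_le {ι α : Type*} {l : Filter α} {a : ι → α → ℝ≥0∞}
    {K : ι → ℝ≥0∞} (ha : ∀ F : Finset ι, ∀ᶠ n in l, ∑ i ∈ F, a i n ≤ 1) (hK : 1 ≤ ∑' i, K i)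
    (hlow : ∀ i, ∀ c < K i, ∀ᶠ n in l, c ≤ a i n) (i : ι) : Tendsto (a i) l (𝓝 (K i)) := by
  classical
  have hlow' : ∀ j, ∀ c < K j, ∀ᶠ n in l, c < a j n := by
    intro j c hc
    obtain ⟨d, hcd, hdK⟩ := exists_between hc
    exact (hlow j d hdK).mono fun n hn => hcd.trans_le hn
  have hmin : ∀ j, Tendsto (fun n => min (a j n) (K j)) l (𝓝 (K j)) := by
    intro j
    refine tendsto_order.2 ⟨fun c hc => (hlow' j c hc).mono fun n hn => lt_min hn hc,
      fun c hc => Eventually.of_forall fun n => (min_le_right _ _).trans_lt hc⟩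
  refine tendsto_order.2 ⟨hlow' i, fun c hc => ?_⟩
  rcases lt_or_ge 1 c with h1 | h1
  · refine (ha {i}).mono fun n hn => ?_
    rw [Finset.sum_singleton] at hn
    exact hn.trans_lt h1
  have hctop : c ≠ ⊤ := (h1.trans_lt ENNReal.one_lt_top).ne
  have hrest : 1 - c < ∑' j, if j = i then 0 else K j := by
    by_contra! hle
    rw [ENNReal.tsum_eq_add_tsum_ite i] at hK
    have : (1 : ℝ≥0∞) < 1 := calc
      1 ≤ K i + ∑' j, (if j = i then 0 else K j) := hK
      _ ≤ K i + (1 - c) := by gcongr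
      _ < c + (1 - c) := ENNReal.add_lt_add_right (by simp) hc
      _ = 1 := add_tsub_cancel_of_le h1
    exact lt_irrefl _ this
  rw [ENNReal.tsum_eq_iSup_sum, lt_iSup_iff] at hrest
  obtain ⟨F, hF⟩ := hrest
  have hF' : 1 - c < ∑ j ∈ F.erase i, K j := by
    refine hF.trans_le ?_
    rw [← Finset.sum_filter_add_sum_filter_not F (fun j => j = i),
      Finset.sum_eq_zero fun j hj => if_pos (Finset.mem_filter.1 hj).2, zero_add]
    refine (Finset.sum_le_sum (g := K) fun j _ => ?_).trans_eq ?_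
    · split_ifs <;> simp
    · congr 1
      ext j
      simp [and_comm]
  have hsum := tendsto_finsetSum (F.erase i) fun j _ => hmin j
  filter_upwards [hsum.eventually_const_lt hF', ha (insert i (F.erase i))] with n hn1 hn2
  rw [Finset.sum_insert (Finset.notMem_erase i F)] at hn2
  by_contra! hca
  have : (1 : ℝ≥0∞) < 1 := calc
    1 = c + (1 - c) := (add_tsub_cancel_of_le h1).symm
    _ < c + ∑ j ∈ F.erase i, min (a j n) (K j) := ENNReal.add_lt_add_left hctop hn1
    _ ≤ a i n + ∑ j ∈ F.erase i, a j n := by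
        gcongr
        exact min_le_left _ _
    _ ≤ 1 := hn2
  exact lt_irrefl _ this

/-- **Corollary (local convergence under conditioning on the width).**
Let `τ` be a critical GW tree with offspring distribution `p` having bounded support.
Then, along `{n ∈ ℕ : P[W(τ) = n] > 0}`, `τ` conditioned on `{W(τ) = n}` converges
locally in distribution to Kesten's immortal tree `τ*`. -/
theorem gw_width_probability_local_convergence
    {Ω : Type*} [MeasurableSpace Ω] (P : Measure Ω) [IsProbabilityMeasure P]
    (p : PMF ℕ) (hp1 : p 1 < 1) (hcrit : mean p = 1)
    (hbdd : ∃ N : ℕ, ∀ k : ℕ, N < k → p k = 0)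
    (τ : Ω → Set Node) (hGW : IsGW P p τ) :
    ∀ h : ℕ, 1 ≤ h → ∀ t : Set Node, IsTree t → height t ≤ (h : ℕ∞) →
      Tendsto
        (fun n : ℕ =>
          P ({ω | restrict h (τ ω) = t} ∩ {ω | width (τ ω) = (n : ℕ∞)}) /
            P {ω | width (τ ω) = (n : ℕ∞)})
        (atTop ⊓ 𝓟 {n : ℕ | P {ω | width (τ ω) = (n : ℕ∞)} ≠ 0})
        (𝓝 (kesten p h t)) := by
  intro h hh t ht hht
  obtain ⟨N₀, hN₀⟩ := hbdd
  have hfin := hGW.measure_finTrees hp1 hcrit ⟨N₀, hN₀⟩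
  obtain ⟨N, hN1, hN⟩ : ∃ N : ℕ, 1 ≤ N ∧ ∀ k : ℕ, N < k → p k = 0 :=
    ⟨N₀ + 1, by omega, fun k hk => hN₀ k (by omega)⟩
  let ι := {t : Set Node | IsTree t ∧ ∀ u ∈ t, u.length ≤ h}
  refine tendsto_of_forall_lt_eventually_le (ι := ι) (a := fun s (n : ℕ) =>
    P ({ω | restrict h (τ ω) = s} ∩ {ω | width (τ ω) = (n : ℕ∞)}) /
      P {ω | width (τ ω) = (n : ℕ∞)}) (K := fun s => kesten p h s) ?_
    (hGW.one_le_tsum_kesten hfin hcrit hh) ?_ ⟨t, ht, height_le_iff.1 hht⟩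
  · refine fun F => Eventually.of_forall fun n => ?_
    simp_rw [div_eq_mul_inv]
    rw [← Finset.sum_mul, ← div_eq_mul_inv]
    refine ENNReal.div_le_of_le_mul ?_
    rw [one_mul]
    set B := {ω | width (τ ω) = (n : ℕ∞)}
    have hres : ∀ s : ι, P ({ω | restrict h (τ ω) = s} ∩ B) =
        P.restrict B {ω | restrict h (τ ω) = s} := fun s =>
      (Measure.restrict_apply (hGW.measurableSet_restrict h _)).symm
    simp_rw [hres]
    rw [← measure_biUnion_finset ?_ fun s _ => hGW.measurableSet_restrict h _]
    · exact (measure_mono (Set.subset_univ _)).trans (by simp)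
    · intro s _ s' _ hne
      exact Set.disjoint_left.2 fun ω (h1 : _ = _) (h2 : _ = _) =>
        hne (Subtype.ext (h1.symm.trans h2))
  · rintro ⟨s, hs, hsh⟩ c hc
    have hKtop : kesten p h s ≠ ⊤ := by
      rw [kesten, hcrit, ← hGW.2.2 h hh s hs (height_le_iff.2 hsh)]
      simp [ENNReal.mul_eq_top]
    have hlim : Tendsto (fun m : ℕ => kesten p h s *
        P {ω | τ ω ∈ {s ∈ finTrees | ∀ w ∈ s, w.length < m}} ^ (Y h s - 1)) atTop
        (𝓝 (kesten p h s)) := by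
      simpa using ENNReal.Tendsto.const_mul
        (ENNReal.Tendsto.pow (n := Y h s - 1) (tendsto_measure_height_lt hfin)) (Or.inr hKtop)
    obtain ⟨m, hm⟩ := (hlim.eventually_const_lt hc).exists
    filter_upwards [(eventually_gt_atTop (N ^ (h + m))).filter_mono inf_le_left,
      mem_inf_of_right (mem_principal_self _)] with n hn hpos
    rw [ENNReal.le_div_iff_mul_le (Or.inl hpos) (Or.inl (measure_ne_top _ _))]
    refine le_trans ?_ (hGW.kesten_mul_le hp1 hcrit hN1 hN hs hsh hn)
    gcongr

end GWLocal
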